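/- Let m ≥ 1, let μ be a 2m×2m matrix over F_2, and let V ⊆ F_2^{2m} be a subspace such that V μ ⊆ V and such that for every integer t ≥ 1 the left null space {M ∈ F_2^{2m} : M μ^t = 0} is contained in V. Then for every M ∈ V^⊥ there exists M′ ∈ V^⊥ such that M ⋆ T = M′ ⋆ (T μ) for all T ∈ F_2^{2m}. -/

import Mathlib

open Matrix

/-- The 2N×2N binary matrix Λ_N, block diagonal with N copies of [[0,1],[1,0]]. -/
def lambdaMat (N : ℕ) : Matrix (Fin (2 * N)) (Fin (2 * N)) (ZMod 2) :=
  Matrix.of fun i j => if i.val / 2 = j.val / 2 ∧ i ≠ j then 1 else 0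

/-- The symplectic product P ⋆ Q = P Λ_N Qᵀ of row vectors P, Q ∈ F_2^{2N}. -/
def sstar {N : ℕ} (P Q : Fin (2 * N) → ZMod 2) : ZMod 2 :=
  Matrix.vecMul P (lambdaMat N) ⬝ᵥ Q

/-- A 2N×2N binary matrix is symplectic if U Λ_N Uᵀ = Λ_N.  A seed transformation of a
quantum convolutional encoder with parameters (n,k,m) is a symplectic 2(n+m)×2(n+m) matrix. -/
def IsSymplectic {N : ℕ} (U : Matrix (Fin (2 * N)) (Fin (2 * N)) (ZMod 2)) : Prop :=
  U * lambdaMat N * Uᵀ = lambdaMat N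


/-- The orthogonal complement of a subspace W ⊆ F_2^{2m} under the symplectic product. -/
def sperp (m : ℕ) (W : Submodule (ZMod 2) (Fin (2 * m) → ZMod 2)) :
    Set (Fin (2 * m) → ZMod 2) :=
  {M | ∀ T ∈ W, sstar M T = 0}

/-- A stable subspace of an Artinian module that contains the kernels of all positive powers of an
endomorphism is equal to its own preimage. -/
theorem mem_of_apply_mem_of_ker_pow_le {R E : Type*} [Ring R] [AddCommGroup E] [Module R E]
    [IsArtinian R E] (f : Module.End R E) (V : Submodule R E) (hstable : V ≤ V.comap f)
    (hker : ∀ t : ℕ, 1 ≤ t → LinearMap.ker (f ^ t) ≤ V) {x : E} (hx : f x ∈ V) : x ∈ V := by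
  have hanti : Antitone fun n : ℕ => V.map (f ^ n) := by
    refine antitone_nat_of_succ_le fun n => ?_
    rintro _ ⟨v, hv, rfl⟩
    exact ⟨f v, hstable hv, by rw [pow_succ, Module.End.mul_apply]⟩
  obtain ⟨n, hn⟩ := IsArtinian.monotone_stabilizes
    (⟨fun n => OrderDual.toDual (V.map (f ^ n)), hanti⟩ : ℕ →o (Submodule R E)ᵒᵈ)
  have hmap : V.map (f ^ n) = V.map (f ^ (n + 1)) := hn (n + 1) n.le_succ
  have hmem : (f ^ (n + 1)) x ∈ V.map (f ^ n) :=
    ⟨f x, hx, by rw [pow_succ, Module.End.mul_apply]⟩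
  rw [hmap] at hmem
  obtain ⟨v, hv, hvx⟩ := hmem
  have hsub : x - v ∈ V := hker (n + 1) n.succ_pos (by
    rw [LinearMap.mem_ker, map_sub, hvx, sub_self])
  simpa using V.add_mem hsub hv

/-- Under the same hypotheses, every functional vanishing on the subspace factors through the
endomorphism via a functional vanishing on the subspace. -/
theorem exists_dual_comp_eq_of_ker_pow_le {K E : Type*} [Field K] [AddCommGroup E] [Module K E]
    [FiniteDimensional K E] (f : Module.End K E) (V : Submodule K E) (hstable : V ≤ V.comap f)
    (hker : ∀ t : ℕ, 1 ≤ t → LinearMap.ker (f ^ t) ≤ V) (φ : Module.Dual K E)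
    (hφ : V ≤ LinearMap.ker φ) :
    ∃ ψ : Module.Dual K E, V ≤ LinearMap.ker ψ ∧ ∀ x, ψ (f x) = φ x := by
  have hinj : Function.Injective (V.mapQ V f hstable) := by
    rw [← LinearMap.ker_eq_bot, LinearMap.ker_eq_bot']
    intro q hq
    obtain ⟨x, rfl⟩ := V.mkQ_surjective q
    rw [Submodule.mkQ_apply, Submodule.mapQ_apply, Submodule.Quotient.mk_eq_zero] at hq
    rw [Submodule.mkQ_apply, Submodule.Quotient.mk_eq_zero]
    exact mem_of_apply_mem_of_ker_pow_le f V hstable hker hq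
  let e := LinearEquiv.ofInjectiveEndo (V.mapQ V f hstable) hinj
  refine ⟨V.liftQ φ hφ ∘ₗ e.symm.toLinearMap ∘ₗ V.mkQ, fun v hv => ?_, fun x => ?_⟩
  · have h0 : V.mkQ v = 0 := by simpa using hv
    rw [LinearMap.mem_ker, LinearMap.comp_apply, LinearMap.comp_apply, h0, map_zero, map_zero]
  · have hx : V.mkQ (f x) = e (V.mkQ x) := rfl
    rw [LinearMap.comp_apply, LinearMap.comp_apply, hx, LinearEquiv.coe_coe,
      LinearEquiv.symm_apply_apply, Submodule.mkQ_apply, Submodule.liftQ_apply]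

theorem lambdaMat_mul_self (N : ℕ) : lambdaMat N * lambdaMat N = 1 := by
  ext i j
  have hi := i.isLt
  let k : Fin (2 * N) := ⟨if i.val % 2 = 0 then i.val + 1 else i.val - 1, by split_ifs <;> omega⟩
  have hk : k.val = if i.val % 2 = 0 then i.val + 1 else i.val - 1 := rfl
  rw [Matrix.mul_apply, Finset.sum_eq_single k]
  · simp only [lambdaMat, Matrix.of_apply, Matrix.one_apply, Fin.ext_iff, ne_eq]
    split_ifs at hk ⊢ <;> first | rfl | omega
  · intro l _ hl
    have hil : ¬(i.val / 2 = l.val / 2 ∧ i ≠ l) := by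
      rw [ne_eq, Fin.ext_iff] at hl ⊢
      split_ifs at hk <;> omega
    simp only [lambdaMat, Matrix.of_apply, if_neg hil, zero_mul]
  · exact fun h => absurd (Finset.mem_univ k) h

/-- Every linear functional is the symplectic product with some vector. -/
theorem exists_sstar_eq {N : ℕ} (ψ : Module.Dual (ZMod 2) (Fin (2 * N) → ZMod 2)) :
    ∃ P, ∀ Q, sstar P Q = ψ Q := by
  obtain ⟨w, rfl⟩ := (dotProductEquiv (ZMod 2) (Fin (2 * N))).surjective ψ
  refine ⟨w ᵥ* lambdaMat N, fun Q => ?_⟩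
  rw [sstar, Matrix.vecMul_vecMul, lambdaMat_mul_self, Matrix.vecMul_one]
  rfl

theorem vecMulLinear_pow {R n : Type*} [CommSemiring R] [Fintype n] [DecidableEq n]
    (A : Matrix n n R) (t : ℕ) :
    (A ^ t).vecMulLinear = (A.vecMulLinear : Module.End R (n → R)) ^ t := by
  induction t with
  | zero => ext; simp
  | succ t ih =>
    rw [pow_succ' (A.vecMulLinear : Module.End R (n → R)), ← ih]
    refine LinearMap.ext fun x => ?_
    simp [pow_succ, Matrix.vecMul_vecMul]

/-- let μ be a linear map of F_2^{2m} (acting on row vectors on the right)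
and V a subspace with V μ ⊆ V containing the left null space of every positive power of μ.
Then for every M ∈ V^⊥ there is M′ ∈ V^⊥ with M ⋆ T = M′ ⋆ (T μ) for all T. -/
theorem stmt_14 (m : ℕ) (hm : 1 ≤ m)
    (μ : Matrix (Fin (2 * m)) (Fin (2 * m)) (ZMod 2))
    (V : Submodule (ZMod 2) (Fin (2 * m) → ZMod 2))
    (hstable : Submodule.map μ.vecMulLinear V ≤ V)
    (hnull : ∀ t : ℕ, 1 ≤ t → LinearMap.ker (μ ^ t).vecMulLinear ≤ V) :
    ∀ M ∈ sperp m V, ∃ M' ∈ sperp m V,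
      ∀ T : Fin (2 * m) → ZMod 2, sstar M T = sstar M' (Matrix.vecMul T μ) := by
  intro M hM
  obtain ⟨ψ, hψV, hψ⟩ := exists_dual_comp_eq_of_ker_pow_le μ.vecMulLinear V
    (Submodule.map_le_iff_le_comap.mp hstable)
    (fun t ht => vecMulLinear_pow μ t ▸ hnull t ht)
    (dotProductEquiv (ZMod 2) (Fin (2 * m)) (M ᵥ* lambdaMat m)) hM
  obtain ⟨M', hM'⟩ := exists_sstar_eq ψ
  exact ⟨M', fun T hT => (hM' T).trans (hψV hT), fun T => ((hM' _).trans (hψ T)).symm⟩
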